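/- arXiv:1604.07994 — 2 statements merged into one kernel-verified Lean document; each statement's English description precedes it below -/
import Mathlib

section
/- Let R¹ = [[0,0,0],[0,0,-1],[0,1,0]], R² = [[0,0,1],[0,0,0],[-1,0,0]], R³ = [[0,-1,0],[1,0,0],[0,0,0]] be 3×3 matrices and for T ∈ ℝ^{3×3} let dev T := T − (tr(T)/3)·Id denote its deviatoric (trace-free) part. Then for every T ∈ ℝ^{3×3} one has dev T = ∑_{j=1}^{3} R^j (dev T)ᵀ R^j. -/
open Matrix

/-- The three 3×3 rotation-generator matrices `R¹, R², R³`. -/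
def R3 : Fin 3 → Matrix (Fin 3) (Fin 3) ℝ :=
  ![!![0, 0, 0; 0, 0, -1; 0, 1, 0],
    !![0, 0, 1; 0, 0, 0; -1, 0, 0],
    !![0, -1, 0; 1, 0, 0; 0, 0, 0]]

/-- Deviatoric (trace-free) part of a 3×3 matrix: `dev T = T − (tr T / 3)·Id`. -/
noncomputable def dev3 (T : Matrix (Fin 3) (Fin 3) ℝ) : Matrix (Fin 3) (Fin 3) ℝ :=
  T - (Matrix.trace T / 3) • (1 : Matrix (Fin 3) (Fin 3) ℝ)

theorem sum_R3_mul_transpose_mul_R3 (S : Matrix (Fin 3) (Fin 3) ℝ) :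
    ∑ j : Fin 3, R3 j * Sᵀ * R3 j = S - S.trace • (1 : Matrix (Fin 3) (Fin 3) ℝ) := by
  ext a b
  simp only [Fin.sum_univ_three, Matrix.add_apply, Matrix.mul_apply, Matrix.transpose_apply]
  fin_cases a <;> fin_cases b <;>
    simp [R3, Fin.sum_univ_three, Matrix.trace] <;> ring

theorem trace_dev3 (T : Matrix (Fin 3) (Fin 3) ℝ) : (dev3 T).trace = 0 := by
  simp [dev3]

/-- For every `T ∈ ℝ^{3×3}`, `dev T = ∑_j R^j (dev T)ᵀ R^j`. -/
theorem stmt_3 (T : Matrix (Fin 3) (Fin 3) ℝ) :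
    dev3 T = ∑ j : Fin 3, R3 j * (dev3 T)ᵀ * R3 j := by
  rw [sum_R3_mul_transpose_mul_R3, trace_dev3, zero_smul, sub_zero]
end

section
/- Let T̂ = (−1,1)³ and let v : ℝ³ → ℝ³ be a vector field each of whose components is a trilinear polynomial, i.e. of the form a₀ + a₁x + a₂y + a₃z + a₄xy + a₅xz + a₆yz + a₇xyz. Let Π₀ f := (1/8)∫_{T̂} f dx denote the mean value over T̂. Then 2∫_{T̂} ‖dev(sym ∇v)‖_F² dx ≤ (5/3)·( 2∫_{T̂} ‖dev(sym ∇v)‖_F² dx − (1/3)∫_{T̂} (div v − Π₀(div v))² dx ), where sym A := (A + Aᵀ)/2, dev A := A − (tr(A)/3)·Id, and ‖A‖_F² := tr(Aᵀ A). -/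
open MeasureTheory
open scoped BigOperators

/-- Partial derivative `∂_j f` of a scalar field `f : ℝ³ → ℝ` at `x`. -/
noncomputable def pd (f : (Fin 3 → ℝ) → ℝ) (j : Fin 3) (x : Fin 3 → ℝ) : ℝ :=
  fderiv ℝ f x (Pi.single j 1)

/-- The reference hexahedral element `T̂ = (−1,1)³`. -/
def refCube : Set (Fin 3 → ℝ) := Set.univ.pi fun _ => Set.Ioo (-1 : ℝ) 1

/-- Divergence `div v = ∑_j ∂_j v_j`. -/
noncomputable def divv (v : (Fin 3 → ℝ) → (Fin 3 → ℝ)) (x : Fin 3 → ℝ) : ℝ :=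
  ∑ j : Fin 3, pd (fun z => v z j) j x

/-- Entry `(i,j)` of `dev(sym ∇v)` at `x`. -/
noncomputable def devSymEntry (v : (Fin 3 → ℝ) → (Fin 3 → ℝ)) (x : Fin 3 → ℝ)
    (i j : Fin 3) : ℝ :=
  (pd (fun z => v z i) j x + pd (fun z => v z j) i x) / 2
    - (if i = j then divv v x / 3 else 0)

/-- Squared Frobenius norm `‖dev(sym ∇v)‖_F²` at `x`. -/
noncomputable def devSymFrobSq (v : (Fin 3 → ℝ) → (Fin 3 → ℝ)) (x : Fin 3 → ℝ) : ℝ :=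
  ∑ i : Fin 3, ∑ j : Fin 3, (devSymEntry v x i j) ^ 2

/-- The monomial `x₀ ^ k₀ x₁ ^ k₁ x₂ ^ k₂`. -/
def monom (k : Fin 3 → ℕ) (x : Fin 3 → ℝ) : ℝ := ∏ l, x l ^ k l

lemma volume_restrict_refCube :
    (volume : Measure (Fin 3 → ℝ)).restrict refCube
      = Measure.pi fun _ => volume.restrict (Set.Ioo (-1 : ℝ) 1) := by
  rw [refCube, volume_pi, Measure.restrict_pi_pi]

lemma Continuous.integrableOn_refCube {f : (Fin 3 → ℝ) → ℝ} (hf : Continuous f) :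
    IntegrableOn f refCube :=
  (hf.continuousOn.integrableOn_compact (isCompact_univ_pi fun _ : Fin 3 =>
    isCompact_Icc (a := (-1 : ℝ)) (b := 1))).mono_set
      (Set.pi_mono fun _ _ => Set.Ioo_subset_Icc_self)

@[fun_prop]
lemma continuous_monom (k : Fin 3 → ℕ) : Continuous (monom k) := by
  unfold monom
  fun_prop

lemma integral_monom (k : Fin 3 → ℕ) :
    ∫ x in refCube, monom k x = ∏ l, (1 - (-1 : ℝ) ^ (k l + 1)) / (k l + 1) := by
  rw [volume_restrict_refCube]
  refine (integral_fintype_prod_eq_prod (fun l (t : ℝ) => t ^ k l)).trans ?_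
  refine Finset.prod_congr rfl fun l _ => ?_
  rw [← integral_Ioc_eq_integral_Ioo, ← intervalIntegral.integral_of_le (by norm_num),
    integral_pow, one_pow]

lemma integral_sum_monom {ι : Type*} [Fintype ι] (k : ι → Fin 3 → ℕ) (c : ι → ℝ) :
    ∫ x in refCube, ∑ i, c i * monom (k i) x
      = ∑ i, c i * ∏ l, (1 - (-1 : ℝ) ^ (k i l + 1)) / (k i l + 1) := by
  rw [integral_finsetSum _ fun i _ => Continuous.integrableOn_refCube (by fun_prop)]
  simp only [integral_const_mul, integral_monom]

lemma monom_mul_monom (k m : Fin 3 → ℕ) (x : Fin 3 → ℝ) :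
    monom k x * monom m x = monom (k + m) x := by
  simp [monom, ← Finset.prod_mul_distrib, pow_add]

lemma integral_sq_sum_monom {ι : Type*} [Fintype ι] (k : ι → Fin 3 → ℕ) (c : ι → ℝ) :
    ∫ x in refCube, (∑ i, c i * monom (k i) x) ^ 2
      = ∑ p : ι × ι, c p.1 * c p.2 *
        ∏ l, (1 - (-1 : ℝ) ^ (k p.1 l + k p.2 l + 1)) / ((k p.1 l + k p.2 l : ℕ) + 1) := by
  refine Eq.trans ?_
    (integral_sum_monom (fun p : ι × ι => k p.1 + k p.2) fun p => c p.1 * c p.2)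
  congr 1
  ext x
  rw [sq, Finset.sum_mul_sum, Fintype.sum_prod_type]
  simp only [← monom_mul_monom]
  exact Finset.sum_congr rfl fun i _ => Finset.sum_congr rfl fun j _ => by ring

/-- The exponents of the multi-affine monomials of degree at most two. -/
def lowExponents : Fin 7 → Fin 3 → ℕ :=
  ![![0, 0, 0], ![1, 0, 0], ![0, 1, 0], ![0, 0, 1], ![1, 1, 0], ![1, 0, 1], ![0, 1, 1]]

/-- The multi-affine polynomial of degree at most two with coefficients `c`. -/
def lowPoly (c : Fin 7 → ℝ) (x : Fin 3 → ℝ) : ℝ := ∑ i, c i * monom (lowExponents i) x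

@[fun_prop]
lemma continuous_lowPoly (c : Fin 7 → ℝ) : Continuous (lowPoly c) := by
  unfold lowPoly
  fun_prop

lemma lowPoly_apply (c : Fin 7 → ℝ) (x : Fin 3 → ℝ) :
    lowPoly c x = c 0 + c 1 * x 0 + c 2 * x 1 + c 3 * x 2
      + c 4 * (x 0 * x 1) + c 5 * (x 0 * x 2) + c 6 * (x 1 * x 2) := by
  simp [lowPoly, lowExponents, monom, Fin.sum_univ_succ, Fin.prod_univ_succ]
  ring

lemma integral_lowPoly (c : Fin 7 → ℝ) : ∫ x in refCube, lowPoly c x = 8 * c 0 := by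
  refine (integral_sum_monom lowExponents c).trans ?_
  simp [lowExponents, Fin.sum_univ_succ, Fin.prod_univ_succ]
  ring

lemma integral_lowPoly_sq (c : Fin 7 → ℝ) :
    ∫ x in refCube, lowPoly c x ^ 2 = 8 * c 0 ^ 2 + 8 / 3 * (c 1 ^ 2 + c 2 ^ 2 + c 3 ^ 2)
      + 8 / 9 * (c 4 ^ 2 + c 5 ^ 2 + c 6 ^ 2) := by
  refine (integral_sq_sum_monom lowExponents c).trans ?_
  simp [lowExponents, Fintype.sum_prod_type, Fin.sum_univ_succ, Fin.prod_univ_succ]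
  norm_num
  ring

/-- Coefficients of `∂_j` of the trilinear polynomial with coefficients `a`. -/
def gradCoeff (a : Fin 8 → ℝ) : Fin 3 → Fin 7 → ℝ :=
  ![![a 1, 0, a 4, a 5, 0, 0, a 7], ![a 2, a 4, 0, a 6, 0, a 7, 0],
    ![a 3, a 5, a 6, 0, a 7, 0, 0]]

lemma pd_trilinear {f : (Fin 3 → ℝ) → ℝ} {a : Fin 8 → ℝ}
    (hf : ∀ x, f x = a 0 + a 1 * x 0 + a 2 * x 1 + a 3 * x 2
        + a 4 * (x 0 * x 1) + a 5 * (x 0 * x 2) + a 6 * (x 1 * x 2)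
        + a 7 * (x 0 * x 1 * x 2)) (j : Fin 3) (x : Fin 3 → ℝ) :
    pd f j x = lowPoly (gradCoeff a j) x := by
  have h (i : Fin 3) : HasFDerivAt (fun y : Fin 3 → ℝ => y i)
      (ContinuousLinearMap.proj (R := ℝ) (φ := fun _ : Fin 3 => ℝ) i) x :=
    hasFDerivAt_apply i x
  have hpoly := (((((((((h 0).const_mul (a 1)).const_add (a 0)).add ((h 1).const_mul (a 2))).add
    ((h 2).const_mul (a 3))).add (((h 0).mul (h 1)).const_mul (a 4))).add
    (((h 0).mul (h 2)).const_mul (a 5))).add (((h 1).mul (h 2)).const_mul (a 6))).add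
    ((((h 0).mul (h 1)).mul (h 2)).const_mul (a 7)))
  have hderiv := hpoly.congr_of_eventuallyEq (f₁ := f) (.of_forall hf)
  rw [pd, hderiv.fderiv, lowPoly_apply]
  fin_cases j <;> simp [gradCoeff, -mul_eq_mul_left_iff] <;> ring

/-- Coefficients of the divergence. -/
def divCoeff (a : Fin 3 → Fin 8 → ℝ) : Fin 7 → ℝ := fun m => ∑ j, gradCoeff (a j) j m

/-- Coefficients of the entries of `dev(sym ∇v)`. -/
noncomputable def devSymCoeff (a : Fin 3 → Fin 8 → ℝ) (i j : Fin 3) : Fin 7 → ℝ := fun m =>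
  (gradCoeff (a i) j m + gradCoeff (a j) i m) / 2 - (if i = j then divCoeff a m / 3 else 0)

/-- For every vector field `v : ℝ³ → ℝ³` with trilinear (Q₁) components:
`2∫_{T̂} ‖dev(sym ∇v)‖_F² ≤ (5/3)·( 2∫_{T̂} ‖dev(sym ∇v)‖_F²
  − (1/3)∫_{T̂} (div v − Π₀(div v))² )`,
where `Π₀ f = (1/8)∫_{T̂} f` is the mean value over `T̂ = (−1,1)³`. -/
theorem stmt_17 (v : (Fin 3 → ℝ) → (Fin 3 → ℝ)) (a : Fin 3 → Fin 8 → ℝ)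
    (hv : ∀ (x : Fin 3 → ℝ) (i : Fin 3),
      v x i = a i 0 + a i 1 * x 0 + a i 2 * x 1 + a i 3 * x 2
        + a i 4 * (x 0 * x 1) + a i 5 * (x 0 * x 2) + a i 6 * (x 1 * x 2)
        + a i 7 * (x 0 * x 1 * x 2)) :
    2 * ∫ x in refCube, devSymFrobSq v x ≤
      (5 / 3) * (2 * (∫ x in refCube, devSymFrobSq v x)
        - (1 / 3) * ∫ x in refCube,
            (divv v x - (1 / 8) * ∫ y in refCube, divv v y) ^ 2) := by
  have hpd (i j : Fin 3) (x : Fin 3 → ℝ) :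
      pd (fun z => v z i) j x = lowPoly (gradCoeff (a i) j) x :=
    pd_trilinear (fun x => hv x i) j x
  have hdiv (x : Fin 3 → ℝ) : divv v x = lowPoly (divCoeff a) x := by
    simp only [divv, hpd, lowPoly_apply, divCoeff, Fin.sum_univ_three]
    ring
  have hdev (x : Fin 3 → ℝ) (i j : Fin 3) :
      devSymEntry v x i j = lowPoly (devSymCoeff a i j) x := by
    simp only [devSymEntry, hpd, hdiv, lowPoly_apply, devSymCoeff]
    split_ifs <;> ring
  have hdevint : ∫ x in refCube, devSymFrobSq v x
      = ∑ i, ∑ j, ∫ x in refCube, lowPoly (devSymCoeff a i j) x ^ 2 := by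
    simp only [devSymFrobSq, hdev]
    rw [integral_finsetSum _ fun i _ => Continuous.integrableOn_refCube (by fun_prop)]
    refine Finset.sum_congr rfl fun i _ => ?_
    rw [integral_finsetSum _ fun j _ => Continuous.integrableOn_refCube (by fun_prop)]
  have hmean (x : Fin 3 → ℝ) : lowPoly (divCoeff a) x - 1 / 8 * (8 * divCoeff a 0)
      = lowPoly (Function.update (divCoeff a) 0 0) x := by
    simp [lowPoly_apply]
    ring
  simp only [hdevint, hdiv, integral_lowPoly, hmean, integral_lowPoly_sq]
  simp [Fin.sum_univ_three, devSymCoeff, divCoeff, gradCoeff]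
  linarith [sq_nonneg (a 0 1 - a 1 2), sq_nonneg (a 0 1 - a 2 3), sq_nonneg (a 1 2 - a 2 3),
    sq_nonneg (a 0 2 + a 1 1), sq_nonneg (a 0 3 + a 2 1), sq_nonneg (a 1 3 + a 2 2),
    sq_nonneg (a 1 4 - a 2 5), sq_nonneg (a 0 4 - a 2 6), sq_nonneg (a 0 5 - a 1 6),
    sq_nonneg (a 0 6 + a 1 5), sq_nonneg (a 0 6 + a 2 4), sq_nonneg (a 1 5 + a 2 4),
    sq_nonneg (a 0 7), sq_nonneg (a 1 7), sq_nonneg (a 2 7)]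
end
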